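/- (Esnault–Viehweg inequality) Let I be the radical homogeneous ideal of a finite nonempty set of points in complex projective space ℙⁿ with n ≥ 2. Then for all integers 1 ≤ k ≤ m one has (α(I^(k)) + 1)/(k + n − 1) ≤ α(I^(m))/m; in particular (α(I^(k)) + 1)/(k + n − 1) ≤ α̂(I). -/

import Mathlib

open scoped LinearAlgebra.Projectivization

/-- A polynomial `F` in `n + 1` variables vanishes to order at least `m` at the (affine
representative) point `v`: all iterated partial derivatives of order `< m` vanish at `v`. -/
def VanishesToOrder (n m : ℕ) (F : MvPolynomial (Fin (n + 1)) ℂ) (v : Fin (n + 1) → ℂ) : Prop :=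
  ∀ k : ℕ, k < m → ∀ d : Fin k → Fin (n + 1),
    MvPolynomial.eval v ((List.ofFn d).foldl (fun p i => MvPolynomial.pderiv i p) F) = 0

/-- The `m`-th symbolic power of the (radical) ideal of a set `Z` of points of `ℙⁿ`:
all polynomials vanishing to order at least `m` at every point of `Z`. -/
def symbolicPower (n : ℕ) (Z : Set (ℙ ℂ (Fin (n + 1) → ℂ))) (m : ℕ) :
    Set (MvPolynomial (Fin (n + 1)) ℂ) :=
  {F | ∀ P ∈ Z, ∀ (v : Fin (n + 1) → ℂ) (hv : v ≠ 0),
    Projectivization.mk ℂ v hv = P → VanishesToOrder n m F v}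

/-- The initial degree `α` of a set of polynomials: the least `t` such that the set contains
a nonzero homogeneous polynomial of degree `t`. -/
noncomputable def initialDegree (n : ℕ) (S : Set (MvPolynomial (Fin (n + 1)) ℂ)) : ℕ :=
  sInf {t | ∃ F ∈ S, F ≠ 0 ∧ F.IsHomogeneous t}

/-- The Waldschmidt constant `α̂(I) = inf_{m ≥ 1} α(I^(m))/m` of the radical ideal of `Z`. -/
noncomputable def waldschmidt (n : ℕ) (Z : Set (ℙ ℂ (Fin (n + 1) → ℂ))) : ℝ :=
  ⨅ m : ℕ+, (initialDegree n (symbolicPower n Z (m : ℕ)) : ℝ) / ((m : ℕ) : ℝ)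

namespace MvPolynomial

section Translate

variable {σ R : Type*} [CommRing R]

/-- Substitution `X i ↦ X i + v i`; it moves the point `v` to the origin. -/
noncomputable def translate (v : σ → R) : MvPolynomial σ R →ₐ[R] MvPolynomial σ R :=
  aeval fun i => X i + C (v i)

@[simp]
lemma translate_X (v : σ → R) (i : σ) : translate v (X i) = X i + C (v i) := by
  simp [translate]

@[simp]
lemma translate_C (v : σ → R) (a : R) : translate v (C a) = C a := by
  simp [translate]

lemma translate_translate (v w : σ → R) (P : MvPolynomial σ R) :
    translate v (translate w P) = translate (v + w) P := by
  have h : (translate v).comp (translate w) = translate (v + w) := by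
    ext i : 1
    simp [add_assoc]
  exact DFunLike.congr_fun h P

lemma translate_zero (P : MvPolynomial σ R) : translate 0 P = P := by
  have h : translate (0 : σ → R) = AlgHom.id R _ := by
    ext i : 1
    simp
  exact DFunLike.congr_fun h P

lemma translate_neg_translate (v : σ → R) (P : MvPolynomial σ R) :
    translate (-v) (translate v P) = P := by
  rw [translate_translate, neg_add_cancel, translate_zero]

lemma map_translate {S : Type*} [CommRing S] (φ : R →+* S) (v : σ → R) (P : MvPolynomial σ R) :
    map φ (translate v P) = translate (φ ∘ v) (map φ P) := by
  induction P using MvPolynomial.induction_on with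
  | C a => simp
  | add P Q hP hQ => simp [hP, hQ]
  | mul_X P i hP => simp [hP]

lemma eval_translate (v w : σ → R) (P : MvPolynomial σ R) :
    eval w (translate v P) = eval (w + v) P := by
  induction P using MvPolynomial.induction_on with
  | C a => simp
  | add P Q hP hQ => simp [hP, hQ]
  | mul_X P i hP => simp [hP]

lemma pderiv_translate (v : σ → R) (i : σ) (P : MvPolynomial σ R) :
    pderiv i (translate v P) = translate v (pderiv i P) := by
  classical
  induction P using MvPolynomial.induction_on with
  | C a => simp
  | add P Q hP hQ => simp [hP, hQ]
  | mul_X P j hP =>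
    rw [map_mul, pderiv_mul, pderiv_mul, map_add, map_mul, map_mul, hP]
    simp [pderiv_X, Pi.single_apply, apply_ite (translate v)]

lemma totalDegree_aeval_le {τ : Type*} {φ : σ → MvPolynomial τ R}
    (hφ : ∀ i, (φ i).totalDegree ≤ 1) (P : MvPolynomial σ R) :
    (aeval φ P).totalDegree ≤ P.totalDegree := by
  rw [aeval_def, eval₂_eq]
  refine totalDegree_finsetSum_le fun s hs => ?_
  refine (totalDegree_mul _ _).trans ?_
  rw [algebraMap_eq, totalDegree_C, zero_add]
  refine (totalDegree_finsetProd _ _).trans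
    ((Finset.sum_le_sum fun i _ => ?_).trans (le_totalDegree hs))
  exact (totalDegree_pow _ _).trans ((Nat.mul_le_mul_left _ (hφ i)).trans (by simp))

lemma totalDegree_X_le (i : σ) : (X i : MvPolynomial σ R).totalDegree ≤ 1 :=
  (totalDegree_monomial_le _ _).trans (by simp)

lemma totalDegree_translate_le (v : σ → R) (P : MvPolynomial σ R) :
    (translate v P).totalDegree ≤ P.totalDegree :=
  totalDegree_aeval_le (fun i => (totalDegree_add _ _).trans
    (max_le (totalDegree_X_le i) (by simp))) P

lemma totalDegree_translate (v : σ → R) (P : MvPolynomial σ R) :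
    (translate v P).totalDegree = P.totalDegree := by
  refine (totalDegree_translate_le v P).antisymm ?_
  conv_lhs => rw [← translate_neg_translate v P]
  exact totalDegree_translate_le _ _

lemma degreeOf_translate_monomial_le [Nontrivial R] (v : σ → R) (a : σ →₀ ℕ) (i : σ) :
    degreeOf i (translate v (monomial a 1)) ≤ a i := by
  classical
  have hX (j : σ) : degreeOf i (X j + C (v j)) ≤ if i = j then 1 else 0 := by
    refine (degreeOf_add_le _ _ _).trans ?_
    rw [degreeOf_X, degreeOf_C]
    simp
  rw [monomial_eq, map_mul, translate_C, Finsupp.prod, map_prod, map_one, one_mul]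
  refine (degreeOf_prod_le _ _ _).trans ?_
  calc ∑ j ∈ a.support, degreeOf i (translate v (X j ^ a j))
      ≤ ∑ j ∈ a.support, if i = j then a j else 0 := by
        refine Finset.sum_le_sum fun j _ => ?_
        rw [map_pow, translate_X]
        refine (degreeOf_pow_le _ _ _).trans ((Nat.mul_le_mul_left _ (hX j)).trans ?_)
        split_ifs <;> simp
    _ ≤ a i := by
        rw [Finset.sum_ite_eq]
        split_ifs <;> simp

end Translate

section FrobeniusComponent

variable {σ K : Type*} [Field K] (p : ℕ) [Fact p.Prime] [CharP K p] [PerfectRing K p] (e : ℕ)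

/-- Writing `P` as the sum over exponents `b` with entries `< p ^ e` of `(P_b) ^ (p ^ e) * X ^ b`,
this is the polynomial `P_b`. -/
noncomputable def frobeniusComponent (b : σ →₀ ℕ) : MvPolynomial σ K →+ MvPolynomial σ K where
  toFun P := AddMonoidAlgebra.ofCoeff <|
    Finsupp.mapRange (iterateFrobeniusEquiv K p e).symm (map_zero _) <|
      Finsupp.comapDomain (fun c : σ →₀ ℕ => p ^ e • c + b) (AddMonoidAlgebra.coeff P) <| by
        intro c _ c' _ h
        ext i
        have := DFunLike.congr_fun h i
        simpa [(Fact.out : p.Prime).ne_zero] using this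
  map_zero' := by ext; simp
  map_add' P Q := by
    refine AddMonoidAlgebra.ext (Finsupp.ext fun c => ?_)
    simp
    rfl

lemma coeff_frobeniusComponent (b c : σ →₀ ℕ) (P : MvPolynomial σ K) :
    coeff c (frobeniusComponent p e b P) =
      (iterateFrobeniusEquiv K p e).symm (coeff (p ^ e • c + b) P) := rfl

lemma coeff_frobeniusComponent_eq_zero_iff (b c : σ →₀ ℕ) (P : MvPolynomial σ K) :
    coeff c (frobeniusComponent p e b P) = 0 ↔ coeff (p ^ e • c + b) P = 0 := by
  rw [coeff_frobeniusComponent, map_eq_zero_iff _ (RingEquiv.injective _)]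

lemma frobeniusComponent_pow_mul {b : σ →₀ ℕ} (hb : ∀ i, b i < p ^ e) (G P : MvPolynomial σ K) :
    frobeniusComponent p e b (G ^ p ^ e * P) = G * frobeniusComponent p e b P := by
  classical
  induction G using MvPolynomial.induction_on' with
  | add G H hG hH => rw [add_pow_char_pow, add_mul, map_add, hG, hH, add_mul]
  | monomial u r =>
    ext c
    rw [monomial_pow, coeff_frobeniusComponent, coeff_monomial_mul', coeff_monomial_mul']
    have hle : p ^ e • u ≤ p ^ e • c + b ↔ u ≤ c := by
      constructor
      · intro h i
        have h1 : p ^ e * u i ≤ p ^ e * c i + b i := by simpa using h i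
        have h2 := hb i
        by_contra! h3
        nlinarith [Nat.mul_le_mul_left (p ^ e) (Nat.succ_le_of_lt h3)]
      · exact fun h => (nsmul_le_nsmul_right h _).trans le_self_add
    by_cases h : u ≤ c
    · rw [if_pos h, if_pos (hle.2 h), map_mul, coeff_frobeniusComponent]
      congr 1
      · rw [← iterateFrobeniusEquiv_def K p e r, RingEquiv.symm_apply_apply]
      · congr 2
        obtain ⟨d, rfl⟩ := le_iff_exists_add.1 h
        rw [add_tsub_cancel_left, smul_add, add_assoc, add_tsub_cancel_left]
    · rw [if_neg h, if_neg (mt hle.1 h), map_zero]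

lemma frobeniusComponent_C_mul (b : σ →₀ ℕ) (a : K) (P : MvPolynomial σ K) :
    frobeniusComponent p e b (C a * P) =
      C ((iterateFrobeniusEquiv K p e).symm a) * frobeniusComponent p e b P := by
  ext c
  simp [coeff_frobeniusComponent]

/-- A polynomial of degree `< p ^ e` in each variable has constant components. -/
lemma frobeniusComponent_of_degreeOf_lt (b : σ →₀ ℕ) {P : MvPolynomial σ K}
    (hP : ∀ i, degreeOf i P < p ^ e) :
    frobeniusComponent p e b P = C ((iterateFrobeniusEquiv K p e).symm (coeff b P)) := by
  classical
  ext c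
  rw [coeff_C]
  split_ifs with h
  · subst h
    simp [coeff_frobeniusComponent]
  · rw [coeff_frobeniusComponent_eq_zero_iff]
    by_contra hc
    obtain ⟨i, hi⟩ : ∃ i, c i ≠ 0 := by
      by_contra! h0
      exact h (Finsupp.ext fun i => (h0 i).symm)
    have h1 := monomial_le_degreeOf i (mem_support_iff.2 hc)
    have h2 := hP i
    have h3 : (p ^ e • c + b) i = p ^ e * c i + b i := by simp
    have h4 : p ^ e * 1 ≤ p ^ e * c i := Nat.mul_le_mul_left _ (Nat.one_le_iff_ne_zero.2 hi)
    omega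

variable [Fintype σ]

lemma frobeniusComponent_translate_eq_sum (w : σ → K) {b : σ →₀ ℕ}
    (hb : ∀ i, b i < p ^ e) {s : Finset (σ →₀ ℕ)} (hs : ∀ a, a ∈ s ↔ ∀ i, a i < p ^ e)
    (P : MvPolynomial σ K) :
    frobeniusComponent p e b (translate w P) =
      ∑ a ∈ s, C ((iterateFrobeniusEquiv K p e).symm (coeff b (translate w (monomial a 1)))) *
        translate w (frobeniusComponent p e a P) := by
  classical
  induction P using MvPolynomial.induction_on' with
  | add P Q hP hQ => simp only [map_add, hP, hQ, mul_add, Finset.sum_add_distrib]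
  | monomial u r =>
    have hq : 0 < p ^ e := pow_pos (Fact.out : p.Prime).pos _
    set c : σ →₀ ℕ := Finsupp.equivFunOnFinite.symm fun i => u i / p ^ e with hc
    set a : σ →₀ ℕ := Finsupp.equivFunOnFinite.symm fun i => u i % p ^ e with ha
    have ha_lt (i : σ) : a i < p ^ e := Nat.mod_lt _ hq
    have hu : (monomial u r : MvPolynomial σ K) =
        C r * (monomial c 1 ^ p ^ e * monomial a 1) := by
      have hexp : p ^ e • c + a = u := by
        ext i
        simp [hc, ha, Nat.div_add_mod]
      rw [monomial_pow, monomial_mul, C_mul_monomial, hexp]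
      simp
    have hcomp (a' : σ →₀ ℕ) (ha' : a' ∈ s) : frobeniusComponent p e a' (monomial u r) =
        if a = a' then C ((iterateFrobeniusEquiv K p e).symm r) * monomial c 1 else 0 := by
      rw [hu, frobeniusComponent_C_mul, frobeniusComponent_pow_mul p e ((hs a').1 ha'),
        frobeniusComponent_of_degreeOf_lt p e a' fun i =>
          (by simpa [degreeOf_monomial_eq] using ha_lt i), coeff_monomial]
      split_ifs <;> simp
    rw [Finset.sum_eq_single a, hcomp a ((hs a).2 ha_lt), if_pos rfl, hu,
      map_mul (translate w), map_mul (translate w), map_pow, translate_C,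
      frobeniusComponent_C_mul, frobeniusComponent_pow_mul p e hb,
      frobeniusComponent_of_degreeOf_lt p e b fun i =>
        (degreeOf_translate_monomial_le w a i).trans_lt (ha_lt i), map_mul, translate_C]
    · ring
    · intro a' ha' hne
      rw [hcomp a' ha', if_neg hne.symm, map_zero, mul_zero]
    · exact fun h => absurd ((hs a).2 ha_lt) h

/-- The span of the components of `P` is compatible with translation. -/
lemma frobeniusComponent_translate_mem_span (w : σ → K) {b : σ →₀ ℕ} (hb : ∀ i, b i < p ^ e)
    (P : MvPolynomial σ K) :
    frobeniusComponent p e b (translate w P) ∈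
      (Submodule.span K {G | ∃ a : σ →₀ ℕ, (∀ i, a i < p ^ e) ∧
        frobeniusComponent p e a P = G}).map (translate w).toLinearMap := by
  classical
  have hq : 0 < p ^ e := pow_pos (Fact.out : p.Prime).pos _
  have hs (a : σ →₀ ℕ) : a ∈ Finset.Icc 0 (Finsupp.equivFunOnFinite.symm fun _ => p ^ e - 1) ↔
      ∀ i, a i < p ^ e := by
    simp only [Finset.mem_Icc, zero_le, true_and, Finsupp.le_def]
    exact forall_congr' fun i => by simp; omega
  rw [frobeniusComponent_translate_eq_sum p e w hb hs]
  refine Submodule.sum_mem _ fun a ha => ?_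
  rw [C_mul']
  exact Submodule.smul_mem _ _
    (Submodule.mem_map_of_mem (Submodule.subset_span ⟨a, (hs a).1 ha, rfl⟩))

lemma translate_frobeniusComponent_mem_span (w : σ → K) {a : σ →₀ ℕ} (ha : ∀ i, a i < p ^ e)
    (P : MvPolynomial σ K) :
    translate w (frobeniusComponent p e a P) ∈
      Submodule.span K {G | ∃ b : σ →₀ ℕ, (∀ i, b i < p ^ e) ∧
        frobeniusComponent p e b (translate w P) = G} := by
  obtain ⟨G, hG, hGe⟩ := frobeniusComponent_translate_mem_span p e (-w) ha (translate w P)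
  rw [translate_neg_translate] at hGe
  rw [← hGe, AlgHom.toLinearMap_apply, translate_translate, add_neg_cancel, translate_zero]
  exact hG

lemma exists_frobeniusComponent_ne_zero {P : MvPolynomial σ K} (hP : P ≠ 0) :
    ∃ a : σ →₀ ℕ, (∀ i, a i < p ^ e) ∧ frobeniusComponent p e a P ≠ 0 := by
  have hq : 0 < p ^ e := pow_pos (Fact.out : p.Prime).pos _
  obtain ⟨u, hu⟩ := ne_zero_iff.1 hP
  refine ⟨Finsupp.equivFunOnFinite.symm fun i => u i % p ^ e, fun i => Nat.mod_lt _ hq,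
    ne_zero_iff.2 ⟨Finsupp.equivFunOnFinite.symm fun i => u i / p ^ e, ?_⟩⟩
  rw [Ne, coeff_frobeniusComponent_eq_zero_iff]
  convert hu
  ext i
  simp [Nat.div_add_mod]

/-- The Esnault–Viehweg inequality in affine space of dimension at least two over a perfect field
of positive characteristic. -/
lemma degree_bound_of_charP {σ K ι : Type*} [Fintype σ] [Field K] (p : ℕ) [Fact p.Prime]
    [CharP K p] [PerfectRing K p] (hσ : 2 ≤ Fintype.card σ) (w : ι → σ → K)
    {α d k m : ℕ} (hk : 1 ≤ k) (hm : 1 ≤ m) {f : MvPolynomial σ K} (hf : f ≠ 0)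
    (hfd : f.totalDegree ≤ d) (hfm : ∀ j, translate (w j) f ∈ idealOfVars σ K ^ m)
    (hα : ∀ g : MvPolynomial σ K, (∀ c, α ≤ c.degree → coeff c g = 0) →
      (∀ j, translate (w j) g ∈ idealOfVars σ K ^ k) → g = 0)
    (hα' : ∀ g : MvPolynomial σ K, (∀ c, α + 1 ≤ c.degree → coeff c g = 0) →
      (∀ j, translate (w j) g ∈ idealOfVars σ K ^ (k + 1)) → g = 0) :
    (α + 1) * m ≤ (k + Fintype.card σ - 1) * d := by
  by_contra! hlt
  obtain ⟨r, hr⟩ : ∃ r, r = k + Fintype.card σ - 1 := ⟨_, rfl⟩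
  rw [← hr] at hlt
  obtain ⟨e, he⟩ : ∃ e, d * m < p ^ e := pow_unbounded_of_one_lt _ (Fact.out : p.Prime).one_lt
  obtain ⟨q, hq⟩ : ∃ q, q = p ^ e := ⟨_, rfl⟩
  obtain ⟨N, hN, hN'⟩ : ∃ N, q * r ≤ m * N ∧ m * N < q * r + m := by
    refine ⟨(q * r + m - 1) / m, ?_, ?_⟩
    · have := Nat.div_add_mod (q * r + m - 1) m
      have := Nat.mod_lt (q * r + m - 1) hm
      omega
    · have := Nat.mul_div_le (q * r + m - 1) m
      omega
  have hD : d * N < q * (α + 1) := by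
    rw [← hq] at he
    by_contra! h
    nlinarith [Nat.mul_le_mul_left m h, Nat.mul_le_mul_left d hN'.le,
      Nat.mul_le_mul_left q (Nat.succ_le_of_lt hlt)]
  have hdeg : (f ^ N).totalDegree ≤ d * N :=
    (totalDegree_pow _ _).trans (by rw [mul_comm d]; exact Nat.mul_le_mul_left _ hfd)
  have hord (j : ι) : translate (w j) (f ^ N) ∈ idealOfVars σ K ^ (m * N) := by
    rw [map_pow, pow_mul]
    exact Ideal.pow_mem_pow (hfm j) N
  have hdegree (c b : σ →₀ ℕ) : (p ^ e • c + b).degree = q * c.degree + b.degree := by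
    rw [map_add, map_nsmul, smul_eq_mul, hq]
  have htransfer (l : ℕ) (j : ι) (hl : ∀ b : σ →₀ ℕ, (∀ i, b i < p ^ e) →
      frobeniusComponent p e b (translate (w j) (f ^ N)) ∈ idealOfVars σ K ^ l) :
      ∀ a : σ →₀ ℕ, (∀ i, a i < p ^ e) →
        translate (w j) (frobeniusComponent p e a (f ^ N)) ∈ idealOfVars σ K ^ l := by
    intro a ha
    refine (Submodule.span_le (p := (idealOfVars σ K ^ l).restrictScalars K)).2 ?_
      (translate_frobeniusComponent_mem_span p e (w j) ha (f ^ N))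
    rintro _ ⟨b, hb, rfl⟩
    exact hl b hb
  have hvanish (j : ι) : ∀ a : σ →₀ ℕ, (∀ i, a i < p ^ e) →
      translate (w j) (frobeniusComponent p e a (f ^ N)) ∈ idealOfVars σ K ^ k := by
    refine htransfer k j fun b hb => ?_
    rw [mem_pow_idealOfVars_iff']
    intro c hc
    rw [coeff_frobeniusComponent_eq_zero_iff]
    refine (mem_pow_idealOfVars_iff' _ _).1 (hord j) _ (lt_of_lt_of_le ?_ hN)
    have hbd : b.degree ≤ Fintype.card σ * (q - 1) := by
      rw [Finsupp.degree_eq_sum, ← smul_eq_mul, ← Finset.card_univ]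
      exact Finset.sum_le_card_nsmul _ _ _ fun i _ => by have := hb i; omega
    have hq0 : 0 < q := hq ▸ pow_pos (Fact.out : p.Prime).pos _
    rw [hdegree, hr]
    obtain ⟨q, rfl⟩ : ∃ q', q = q' + 1 := ⟨q - 1, by omega⟩
    obtain ⟨k, rfl⟩ : ∃ k', k = k' + 1 := ⟨k - 1, by omega⟩
    rw [show k + 1 + Fintype.card σ - 1 = k + Fintype.card σ by omega]
    simp only [Nat.add_sub_cancel] at hbd
    nlinarith [Nat.mul_le_mul_left (q + 1) (Nat.le_of_lt_succ hc)]
  have hvanish' (j : ι) : ∀ a : σ →₀ ℕ, (∀ i, a i < p ^ e) →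
      translate (w j) (frobeniusComponent p e a (f ^ N)) ∈ idealOfVars σ K ^ (k + 1) := by
    refine htransfer (k + 1) j fun b hb => ?_
    by_cases h0 : frobeniusComponent p e b (translate (w j) (f ^ N)) = 0
    · rw [h0]
      exact zero_mem _
    obtain ⟨g, hg, hgb⟩ := frobeniusComponent_translate_mem_span p e (w j) hb (f ^ N)
    rw [AlgHom.toLinearMap_apply] at hgb
    have hg_ne : g ≠ 0 := by
      rintro rfl
      exact h0 (by rw [← hgb, map_zero])
    have hg_ord (i : ι) : translate (w i) g ∈ idealOfVars σ K ^ k := by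
      refine (Submodule.span_le (p := ((idealOfVars σ K ^ k).restrictScalars K).comap
        (translate (w i)).toLinearMap)).2 ?_ hg
      rintro _ ⟨a, ha, rfl⟩
      exact hvanish i a ha
    have hg_deg : α ≤ g.totalDegree := by
      by_contra! h
      exact hg_ne (hα g (fun c hc => coeff_eq_zero_of_totalDegree_lt (h.trans_le hc)) hg_ord)
    obtain ⟨u, hu, hu'⟩ : ∃ u ∈ (frobeniusComponent p e b (translate (w j) (f ^ N))).support,
        (frobeniusComponent p e b (translate (w j) (f ^ N))).totalDegree = u.degree :=
      Finset.exists_mem_eq_sup _ (support_nonempty.2 h0) _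
    rw [← hgb, totalDegree_translate] at hu'
    have h1 := le_totalDegree (mem_support_iff.2
      (mt (coeff_frobeniusComponent_eq_zero_iff p e b u _).2 (mem_support_iff.1 hu)))
    rw [totalDegree_translate] at h1
    have h2 : q * u.degree + b.degree ≤ d * N := by
      rw [← hdegree]
      exact h1.trans hdeg
    rw [mem_pow_idealOfVars_iff']
    intro c hc
    rw [coeff_frobeniusComponent_eq_zero_iff]
    refine (mem_pow_idealOfVars_iff' _ _).1 (hord j) _ (lt_of_lt_of_le ?_ hN)
    rw [hdegree]
    have h3 : q * α ≤ q * u.degree := Nat.mul_le_mul_left _ (hu' ▸ hg_deg)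
    have h4 : q * c.degree ≤ q * k := Nat.mul_le_mul_left _ (Nat.le_of_lt_succ hc)
    have h5 : q * (k + 1) ≤ q * r := Nat.mul_le_mul_left _ (by omega)
    rw [mul_add] at hD h5
    omega
  obtain ⟨a, ha, hne⟩ := exists_frobeniusComponent_ne_zero p e
    (show f ^ N ≠ 0 from pow_ne_zero _ hf)
  refine hne (hα' _ (fun c hc => ?_) fun j => hvanish' j a ha)
  rw [coeff_frobeniusComponent_eq_zero_iff]
  refine coeff_eq_zero_of_totalDegree_lt (hdeg.trans_lt (hD.trans_le ?_))
  change _ ≤ (p ^ e • c + a).degree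
  rw [hdegree]
  nlinarith [Nat.mul_le_mul_left q hc]

end FrobeniusComponent

end MvPolynomial

instance Int.instIsJacobsonRing : IsJacobsonRing ℤ := by
  rw [isJacobsonRing_iff_prime_eq]
  intro P hP
  by_cases h : P = ⊥
  · subst h
    refine eq_bot_iff.2 fun x hx => ?_
    have hu := Ideal.mem_jacobson_bot.1 hx x
    rw [Int.isUnit_iff] at hu
    rw [Ideal.mem_bot]
    rcases hu with hu | hu <;> nlinarith
  · have := hP.isMaximal h
    exact Ideal.jacobson_eq_self_of_isMaximal

universe u

/-- A finitely generated subring of a field maps to an algebraically closed field of positive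
characteristic. -/
lemma exists_ringHom_algClosed_charP {L : Type u} [Field L] {S : Set L} (hS : S.Finite) :
    ∃ (p : ℕ) (K : Type u) (_ : Field K) (_ : IsAlgClosed K), p.Prime ∧ CharP K p ∧
      Nonempty (Algebra.adjoin ℤ S →+* K) := by
  set A := Algebra.adjoin ℤ S
  obtain ⟨M, hM⟩ := Ideal.exists_maximal A
  let _ : Field (A ⧸ M) := Ideal.Quotient.field M
  have : Algebra.FiniteType ℤ A :=
    (Subalgebra.fg_iff_finiteType _).1 ⟨hS.toFinset, by simp [A]⟩
  have : Algebra.FiniteType ℤ (A ⧸ M) :=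
    Algebra.FiniteType.of_surjective (Ideal.Quotient.mkₐ ℤ M) Ideal.Quotient.mk_surjective
  have : Module.Finite ℤ (A ⧸ M) := finite_of_finite_type_of_isJacobsonRing ℤ (A ⧸ M)
  obtain ⟨p, hp⟩ := CharP.exists (A ⧸ M)
  have hp0 : p ≠ 0 := by
    rintro rfl
    have := CharP.charP_to_charZero (A ⧸ M)
    refine Int.not_isField (isField_of_isIntegral_of_isField (R := ℤ) (S := A ⧸ M) ?_
      (Field.toIsField _))
    exact (algebraMap ℤ (A ⧸ M)).injective_int
  refine ⟨p, AlgebraicClosure (A ⧸ M), inferInstance, inferInstance,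
    (CharP.char_is_prime_or_zero (A ⧸ M) p).resolve_right hp0,
    charP_of_injective_algebraMap (algebraMap (A ⧸ M) _).injective p,
    ⟨(algebraMap (A ⧸ M) (AlgebraicClosure (A ⧸ M))).comp (Ideal.Quotient.mk M)⟩⟩

namespace MvPolynomial

section JetMatrix

variable {σ ι R : Type*} [Fintype σ] [CommRing R]

noncomputable instance fintypeDegreeLT (t : ℕ) : Fintype {c : σ →₀ ℕ // c.degree < t} :=
  (Finsupp.finite_of_degree_lt t).fintype

/-- The matrix sending the coefficients of a polynomial of degree `< t` to its Taylor coefficients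
of order `< k` at the points `w j`. -/
noncomputable def jetMatrix (t k : ℕ) (w : ι → σ → R) :
    Matrix (ι × {c : σ →₀ ℕ // c.degree < k}) {b : σ →₀ ℕ // b.degree < t} R :=
  Matrix.of fun jc b => coeff jc.2 (translate (w jc.1) (monomial b 1))

lemma jetMatrix_mulVec (t k : ℕ) (w : ι → σ → R) (x : {b : σ →₀ ℕ // b.degree < t} → R)
    (jc : ι × {c : σ →₀ ℕ // c.degree < k}) :
    (jetMatrix t k w).mulVec x jc =
      coeff jc.2 (translate (w jc.1) (∑ b, monomial b.1 (x b))) := by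
  rw [map_sum, coeff_sum]
  refine Finset.sum_congr rfl fun b _ => ?_
  rw [← mul_one (x b), ← C_mul_monomial, map_mul, translate_C, coeff_C_mul, mul_one, mul_comm]
  rfl

lemma jetMatrix_map {σ ι R S : Type*} [CommRing R] [CommRing S] (φ : R →+* S) (t k : ℕ)
    (w : ι → σ → R) : (jetMatrix t k w).map φ = jetMatrix t k fun j => φ ∘ w j := by
  ext jc b
  simp only [jetMatrix, Matrix.map_apply, Matrix.of_apply, ← coeff_map, map_translate]
  simp

lemma sum_monomial_coeff_of_degree_lt {t : ℕ} {g : MvPolynomial σ R}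
    (hg : ∀ c, t ≤ c.degree → coeff c g = 0) :
    ∑ b : {b : σ →₀ ℕ // b.degree < t}, monomial b.1 (coeff b.1 g) = g := by
  classical
  ext c
  simp only [coeff_sum, coeff_monomial]
  by_cases hc : c.degree < t
  · rw [Finset.sum_eq_single ⟨c, hc⟩ (fun b _ hb => if_neg fun h => hb (Subtype.ext h)) (by simp),
      if_pos rfl]
  · rw [hg c (not_lt.1 hc)]
    exact Finset.sum_eq_zero fun b _ => if_neg fun h => hc (by rw [← h]; exact b.2)

lemma eq_zero_of_jetMatrix_leftInverse [Fintype ι] {t k : ℕ} {w : ι → σ → R}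
    {N : Matrix {b : σ →₀ ℕ // b.degree < t} (ι × {c : σ →₀ ℕ // c.degree < k}) R}
    (hN : ∀ b b', (N * jetMatrix t k w) b b' = if b.1 = b'.1 then 1 else 0)
    {g : MvPolynomial σ R} (hg : ∀ c, t ≤ c.degree → coeff c g = 0)
    (hgk : ∀ j, translate (w j) g ∈ idealOfVars σ R ^ k) : g = 0 := by
  classical
  have hN1 : N * jetMatrix t k w = 1 := by
    ext b b'
    rw [hN, Matrix.one_apply]
    simp [Subtype.ext_iff]
  have h0 : (jetMatrix t k w).mulVec (fun b => coeff b.1 g) = 0 := by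
    funext jc
    rw [jetMatrix_mulVec, sum_monomial_coeff_of_degree_lt hg]
    exact (mem_pow_idealOfVars_iff' _ _).1 (hgk jc.1) _ jc.2.2
  have h1 : (fun b : {b : σ →₀ ℕ // b.degree < t} => coeff b.1 g) = 0 := by
    rw [← Matrix.one_mulVec (fun b : {b : σ →₀ ℕ // b.degree < t} => coeff b.1 g), ← hN1,
      ← Matrix.mulVec_mulVec, h0, Matrix.mulVec_zero]
  rw [← sum_monomial_coeff_of_degree_lt hg]
  exact Finset.sum_eq_zero fun b _ => by rw [congrFun h1 b, Pi.zero_apply, monomial_zero]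

lemma exists_jetMatrix_leftInverse {L : Type*} [Field L] [Fintype ι] {t k : ℕ} {w : ι → σ → L}
    (h : ∀ g : MvPolynomial σ L, (∀ c, t ≤ c.degree → coeff c g = 0) →
      (∀ j, translate (w j) g ∈ idealOfVars σ L ^ k) → g = 0) :
    ∃ N : Matrix {b : σ →₀ ℕ // b.degree < t} (ι × {c : σ →₀ ℕ // c.degree < k}) L,
      ∀ b b', (N * jetMatrix t k w) b b' = if b.1 = b'.1 then 1 else 0 := by
  classical
  have hker : LinearMap.ker (Matrix.toLin' (jetMatrix t k w)) = ⊥ := by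
    refine LinearMap.ker_eq_bot'.2 fun x hx => ?_
    rw [Matrix.toLin'_apply] at hx
    have hcoeff (c : σ →₀ ℕ) : coeff c (∑ b : {b : σ →₀ ℕ // b.degree < t}, monomial b.1 (x b)) =
        if hc : c.degree < t then x ⟨c, hc⟩ else 0 := by
      simp only [coeff_sum, coeff_monomial]
      split_ifs with hc
      · rw [Finset.sum_eq_single ⟨c, hc⟩ (fun b _ hb => if_neg fun h => hb (Subtype.ext h))
          (by simp), if_pos rfl]
      · exact Finset.sum_eq_zero fun b _ => if_neg fun h => hc (by rw [← h]; exact b.2)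
    have hzero := h (∑ b : {b : σ →₀ ℕ // b.degree < t}, monomial b.1 (x b))
      (fun c hc => by rw [hcoeff, dif_neg hc.not_gt]) fun j => by
        rw [mem_pow_idealOfVars_iff']
        intro c hc
        have := congrFun hx (j, ⟨c, hc⟩)
        rwa [jetMatrix_mulVec] at this
    funext b
    have := hcoeff b.1
    rw [hzero, dif_pos b.2] at this
    exact this.symm
  obtain ⟨g, hg⟩ := LinearMap.exists_leftInverse_of_injective _ hker
  refine ⟨LinearMap.toMatrix' g, fun b b' => ?_⟩
  have : LinearMap.toMatrix' g * jetMatrix t k w = 1 := by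
    rw [← LinearMap.toMatrix'_toLin' (jetMatrix t k w), ← LinearMap.toMatrix'_comp, hg,
      LinearMap.toMatrix'_id]
  rw [this, Matrix.one_apply]
  simp [Subtype.ext_iff]

end JetMatrix

/-- Absence of polynomials of degree `< t` vanishing to order `k` at given points persists under
specialization, provided the ring being specialized contains a suitable finite set. -/
lemma exists_finite_specialization {σ ι : Type*} {L : Type u} [Fintype σ] [Field L] [Fintype ι]
    {t k : ℕ} {w : ι → σ → L}
    (h : ∀ g : MvPolynomial σ L, (∀ c, t ≤ c.degree → coeff c g = 0) →
      (∀ j, translate (w j) g ∈ idealOfVars σ L ^ k) → g = 0) :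
    ∃ S : Set L, S.Finite ∧ ∀ (A : Subalgebra ℤ L), S ⊆ A →
      ∀ (K : Type u) [Field K] (φ : A →+* K) (w' : ι → σ → A), (∀ j i, (w' j i : L) = w j i) →
      ∀ g : MvPolynomial σ K, (∀ c, t ≤ c.degree → coeff c g = 0) →
      (∀ j, translate (φ ∘ w' j) g ∈ idealOfVars σ K ^ k) → g = 0 := by
  obtain ⟨N, hN⟩ := exists_jetMatrix_leftInverse h
  refine ⟨Set.range fun x : _ × _ => N x.1 x.2, Set.finite_range _, ?_⟩
  intro A hA K _ φ w' hw' g hg hgk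
  have hNA (b jc) : N b jc ∈ A := hA ⟨(b, jc), rfl⟩
  set NA : Matrix {b : σ →₀ ℕ // b.degree < t} (ι × {c : σ →₀ ℕ // c.degree < k}) A :=
    Matrix.of fun b jc => ⟨N b jc, hNA b jc⟩ with hNAdef
  have h1 (b b') : (NA * jetMatrix t k w') b b' = if b.1 = b'.1 then 1 else 0 := by
    apply Subtype.val_injective
    have h2 := hN b b'
    have h3 : jetMatrix t k w = (jetMatrix t k w').map A.val.toRingHom := by
      rw [jetMatrix_map]
      congr 1
      funext j i
      exact (hw' j i).symm
    rw [h3] at h2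
    have h4 : N = NA.map A.val.toRingHom := rfl
    rw [h4, ← Matrix.map_mul] at h2
    refine h2.trans ?_
    split_ifs <;> rfl
  refine eq_zero_of_jetMatrix_leftInverse (w := fun j => φ ∘ w' j) (N := NA.map φ)
    (fun b b' => ?_) hg hgk
  rw [← jetMatrix_map, ← Matrix.map_mul, Matrix.map_apply, h1]
  split_ifs <;> simp

/-- The Esnault–Viehweg inequality in affine space of dimension at least two. -/
lemma degree_bound {σ ι : Type*} {L : Type u} [Fintype σ] [Fintype ι] [Field L]
    (hσ : 2 ≤ Fintype.card σ) (w : ι → σ → L)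
    {α d k m : ℕ} (hk : 1 ≤ k) (hm : 1 ≤ m) {f : MvPolynomial σ L} (hf : f ≠ 0)
    (hfd : f.totalDegree ≤ d) (hfm : ∀ j, translate (w j) f ∈ idealOfVars σ L ^ m)
    (hα : ∀ g : MvPolynomial σ L, (∀ c, α ≤ c.degree → coeff c g = 0) →
      (∀ j, translate (w j) g ∈ idealOfVars σ L ^ k) → g = 0)
    (hα' : ∀ g : MvPolynomial σ L, (∀ c, α + 1 ≤ c.degree → coeff c g = 0) →
      (∀ j, translate (w j) g ∈ idealOfVars σ L ^ (k + 1)) → g = 0) :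
    (α + 1) * m ≤ (k + Fintype.card σ - 1) * d := by
  classical
  obtain ⟨S₁, hS₁, hspec⟩ := exists_finite_specialization hα
  obtain ⟨S₂, hS₂, hspec'⟩ := exists_finite_specialization hα'
  obtain ⟨u, hu⟩ := ne_zero_iff.1 hf
  set S : Set L := S₁ ∪ S₂ ∪ (Set.range fun x : ι × σ => w x.1 x.2) ∪ f.coeffs ∪ {(coeff u f)⁻¹}
    with hS
  have hSfin : S.Finite :=
    (((hS₁.union hS₂).union (Set.finite_range _)).union (Finset.finite_toSet _)).union
      (Set.finite_singleton _)
  have hSA : S ⊆ Algebra.adjoin ℤ S := Algebra.subset_adjoin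
  obtain ⟨p, K, _, _, hp, _, ⟨φ⟩⟩ := exists_ringHom_algClosed_charP hSfin
  have : Fact p.Prime := ⟨hp⟩
  set A := Algebra.adjoin ℤ S
  let w' : ι → σ → A := fun j i => ⟨w j i, hSA (by simp [hS])⟩
  obtain ⟨f', hf'⟩ : f ∈ Set.range (map A.val.toRingHom) := by
    rw [mem_range_map_iff_coeffs_subset]
    intro a ha
    exact ⟨⟨a, hSA (by simp [hS, ha])⟩, rfl⟩
  have hinj : Function.Injective A.val.toRingHom := Subtype.val_injective
  have hcoeff (c : σ →₀ ℕ) : A.val.toRingHom (coeff c f') = coeff c f := by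
    rw [← hf', coeff_map]
  refine degree_bound_of_charP p hσ (fun j => φ ∘ w' j) hk hm (f := map φ f') ?_ ?_ ?_
    (hspec A (fun a ha => hSA (by simp [hS, ha])) K φ w' fun _ _ => rfl)
    (hspec' A (fun a ha => hSA (by simp [hS, ha])) K φ w' fun _ _ => rfl)
  · refine ne_zero_iff.2 ⟨u, ?_⟩
    rw [coeff_map]
    refine IsUnit.ne_zero (IsUnit.map φ (IsUnit.of_mul_eq_one
      ⟨(coeff u f)⁻¹, hSA (by simp [hS])⟩ ?_))
    apply hinj
    rw [map_mul, hcoeff, map_one]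
    exact mul_inv_cancel₀ hu
  · refine (Finset.sup_mono fun c hc => ?_).trans hfd
    have hc' := support_map_subset _ _ hc
    rw [mem_support_iff] at hc' ⊢
    rwa [← hcoeff, Ne, map_eq_zero_iff _ hinj]
  · intro j
    rw [← map_translate, mem_pow_idealOfVars_iff']
    intro c hc
    have h0 : coeff c (translate (w' j) f') = 0 := by
      apply hinj
      rw [map_zero, ← coeff_map, map_translate, hf']
      exact (mem_pow_idealOfVars_iff' _ _).1 (hfm j) c hc
    rw [coeff_map, h0, map_zero]

section Derivatives

variable {σ R : Type*} [CommRing R]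

lemma pderiv_mem_pow_idealOfVars {m : ℕ} {P : MvPolynomial σ R}
    (hP : P ∈ idealOfVars σ R ^ (m + 1)) (i : σ) : pderiv i P ∈ idealOfVars σ R ^ m := by
  rw [mem_pow_idealOfVars_iff'] at hP ⊢
  intro c hc
  rw [coeff_pderiv, hP _ (by simpa using hc), zero_mul]

lemma exists_eq_add_single {c : σ →₀ ℕ} (hc : c ≠ 0) :
    ∃ (c' : σ →₀ ℕ) (i : σ), c = c' + Finsupp.single i 1 := by
  obtain ⟨i, hi⟩ := Finsupp.ne_iff.1 hc
  refine ⟨c - Finsupp.single i 1, i, (tsub_add_cancel_of_le ?_).symm⟩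
  exact Finsupp.single_le_iff.2 (Nat.one_le_iff_ne_zero.2 hi)

lemma coeff_eq_zero_of_pderiv [IsDomain R] [CharZero R] {P : MvPolynomial σ R} {c : σ →₀ ℕ}
    {i : σ} (h : coeff c (pderiv i P) = 0) : coeff (c + Finsupp.single i 1) P = 0 := by
  rw [coeff_pderiv] at h
  exact (mul_eq_zero.1 h).resolve_right (Nat.cast_add_one_ne_zero (c i))

lemma mem_pow_idealOfVars_iff_foldl_pderiv [IsDomain R] [CharZero R] (m : ℕ)
    (P : MvPolynomial σ R) :
    (∀ l : List σ, l.length < m → eval 0 (l.foldl (fun Q i => pderiv i Q) P) = 0) ↔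
      P ∈ idealOfVars σ R ^ m := by
  induction m generalizing P with
  | zero => simp
  | succ m ih =>
    constructor
    · intro h
      rw [mem_pow_idealOfVars_iff']
      intro c hc
      by_cases h0 : c = 0
      · subst h0
        simpa [eval_zero, constantCoeff_eq] using h [] (Nat.succ_pos m)
      · obtain ⟨c', i, rfl⟩ := exists_eq_add_single h0
        refine coeff_eq_zero_of_pderiv
          ((mem_pow_idealOfVars_iff' m _).1 ((ih (pderiv i P)).1 fun l hl => ?_) c' ?_)
        · exact h (i :: l) (by simpa using hl)
        · simpa using hc
    · intro h l hl
      cases l with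
      | nil =>
        simpa [eval_zero, constantCoeff_eq] using
          (mem_pow_idealOfVars_iff' _ _).1 h 0 (by simp)
      | cons i l =>
        exact (ih (pderiv i P)).2 (pderiv_mem_pow_idealOfVars h i) l (by simpa using hl)

end Derivatives

lemma aeval_mem_pow_idealOfVars {σ τ R : Type*} [CommRing R] {φ : σ → MvPolynomial τ R}
    (hφ : ∀ i, φ i ∈ idealOfVars τ R) {m : ℕ} {P : MvPolynomial σ R}
    (hP : P ∈ idealOfVars σ R ^ m) : aeval φ P ∈ idealOfVars τ R ^ m := by
  have h1 := Ideal.mem_map_of_mem (aeval φ) hP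
  rw [Ideal.map_pow] at h1
  refine Ideal.pow_right_mono ?_ m h1
  rw [idealOfVars, Ideal.map_span, Ideal.span_le]
  rintro _ ⟨_, ⟨i, rfl⟩, rfl⟩
  simpa using hφ i

lemma X_mem_idealOfVars {σ R : Type*} [CommRing R] (i : σ) :
    (X i : MvPolynomial σ R) ∈ idealOfVars σ R :=
  Ideal.subset_span ⟨i, rfl⟩

/-- In characteristic zero, the least degree of a polynomial vanishing to order `k` at given points
increases strictly with `k`. -/
lemma eq_zero_of_succ_order {σ ι L : Type*} [Field L] [CharZero L] [Nonempty ι]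
    {w : ι → σ → L} {α k : ℕ}
    (hα : ∀ g : MvPolynomial σ L, (∀ c, α ≤ c.degree → coeff c g = 0) →
      (∀ j, translate (w j) g ∈ idealOfVars σ L ^ k) → g = 0)
    (g : MvPolynomial σ L) (hg : ∀ c, α + 1 ≤ c.degree → coeff c g = 0)
    (hgk : ∀ j, translate (w j) g ∈ idealOfVars σ L ^ (k + 1)) : g = 0 := by
  classical
  have hderiv (i : σ) : pderiv i g = 0 := by
    refine hα _ (fun c hc => ?_) fun j => ?_
    · rw [coeff_pderiv, hg _ (by simpa using hc), zero_mul]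
    · rw [← pderiv_translate]
      exact pderiv_mem_pow_idealOfVars (hgk j) i
  have hconst : g = C (coeff 0 g) := by
    ext c
    rw [coeff_C]
    split_ifs with h
    · rw [h]
    · obtain ⟨c', i, rfl⟩ := exists_eq_add_single (Ne.symm h)
      exact coeff_eq_zero_of_pderiv (by rw [hderiv, coeff_zero])
  have h := hgk (Classical.arbitrary ι)
  rw [hconst, translate_C, C_mem_pow_idealOfVars_iff] at h
  rw [hconst, h.resolve_right (Nat.succ_ne_zero k), map_zero]

section Chart

variable {n : ℕ} {L : Type*} [Field L]

/-- The linear form `x₀ + ∑ ℓᵢ xᵢ₊₁`. -/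
noncomputable def chartForm (l : Fin n → L) : MvPolynomial (Fin (n + 1)) L :=
  X 0 + ∑ i, C (l i) * X i.succ

lemma eval_chartForm (l : Fin n → L) (x : Fin (n + 1) → L) :
    eval x (chartForm l) = x 0 + ∑ i, l i * x i.succ := by
  simp [chartForm]

lemma translate_chartForm (l : Fin n → L) (v : Fin (n + 1) → L) :
    translate v (chartForm l) = chartForm l + C (eval v (chartForm l)) := by
  simp only [chartForm, map_add, map_sum, map_mul, translate_X, translate_C, mul_add,
    Finset.sum_add_distrib, eval_X, eval_C]
  ring

lemma isHomogeneous_chartForm (l : Fin n → L) : (chartForm l).IsHomogeneous 1 := by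
  refine (isHomogeneous_X _ _).add (IsHomogeneous.sum _ _ _ fun i _ => ?_)
  simpa using (isHomogeneous_C _ (l i)).mul (isHomogeneous_X L i.succ)

lemma chartForm_mem_idealOfVars (l : Fin n → L) :
    chartForm l ∈ idealOfVars (Fin (n + 1)) L :=
  add_mem (X_mem_idealOfVars _)
    (sum_mem fun _ _ => Ideal.mul_mem_left _ _ (X_mem_idealOfVars _))

lemma chartForm_ne_zero (l : Fin n → L) : chartForm l ≠ 0 := by
  intro h
  have := eval_chartForm l (Fin.cons 1 0)
  rw [h] at this
  simp at this

/-- The point of the hyperplane `chartForm l = 1` with last coordinates `y`. -/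
def chartPoint (l : Fin n → L) (y : Fin n → L) : Fin (n + 1) → L :=
  Fin.cons (1 - ∑ i, l i * y i) y

lemma eval_chartPoint_chartForm (l y : Fin n → L) :
    eval (chartPoint l y) (chartForm l) = 1 := by
  simp [eval_chartForm, chartPoint]

lemma eq_smul_chartPoint (l : Fin n → L) {x : Fin (n + 1) → L} (hx : eval x (chartForm l) ≠ 0) :
    x = eval x (chartForm l) • chartPoint l fun i => x i.succ / eval x (chartForm l) := by
  funext i
  refine Fin.cases ?_ (fun i => ?_) i
  · simp only [chartPoint, Pi.smul_apply, Fin.cons_zero, smul_eq_mul, mul_sub, Finset.mul_sum,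
      mul_one]
    rw [eq_sub_iff_add_eq]
    nth_rewrite 3 [eval_chartForm]
    congr 1
    refine Finset.sum_congr rfl fun i _ => ?_
    field_simp
  · simp only [chartPoint, Pi.smul_apply, Fin.cons_succ, smul_eq_mul]
    field_simp

lemma eq_of_eval_eq_of_chartForm_ne_zero [Infinite L] (l : Fin n → L)
    {F G : MvPolynomial (Fin (n + 1)) L}
    (h : ∀ x, eval x (chartForm l) ≠ 0 → eval x F = eval x G) : F = G := by
  refine mul_left_cancel₀ (chartForm_ne_zero l) (MvPolynomial.funext fun x => ?_)
  rw [map_mul, map_mul]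
  by_cases hx : eval x (chartForm l) = 0
  · rw [hx, zero_mul, zero_mul]
  · rw [h x hx]

/-- Restriction of a polynomial to the hyperplane `chartForm l = 1`. -/
noncomputable def dehomogenize (l : Fin n → L) :
    MvPolynomial (Fin (n + 1)) L →ₐ[L] MvPolynomial (Fin n) L :=
  aeval (Fin.cons (1 - ∑ i, C (l i) * X i) X)

lemma eval_dehomogenize (l y : Fin n → L) (F : MvPolynomial (Fin (n + 1)) L) :
    eval y (dehomogenize l F) = eval (chartPoint l y) F := by
  induction F using MvPolynomial.induction_on with
  | C a => simp [dehomogenize]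
  | add P Q hP hQ => simp [hP, hQ]
  | mul_X P i hP =>
    rw [map_mul, map_mul, map_mul, hP]
    congr 1
    refine Fin.cases ?_ (fun i => ?_) i <;> simp [dehomogenize, chartPoint]

lemma totalDegree_dehomogenize_le (l : Fin n → L) (F : MvPolynomial (Fin (n + 1)) L) :
    (dehomogenize l F).totalDegree ≤ F.totalDegree := by
  refine totalDegree_aeval_le (fun i => ?_) F
  refine Fin.cases ?_ (fun i => ?_) i
  · rw [Fin.cons_zero]
    refine (totalDegree_sub _ _).trans (max_le (by simp) (totalDegree_finsetSum_le fun i _ => ?_))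
    exact (totalDegree_mul _ _).trans (by simp)
  · simp

lemma IsHomogeneous.eval_smul_eq {σ : Type*} [Fintype σ] {F : MvPolynomial σ L} {d : ℕ}
    (hF : F.IsHomogeneous d) (a : L) (x : σ → L) : eval (a • x) F = a ^ d * eval x F := by
  rw [eval_eq', eval_eq', Finset.mul_sum]
  refine Finset.sum_congr rfl fun c hc => ?_
  have hcd : c.degree = d := by
    rw [Finsupp.degree_eq_weight_one]
    exact hF (mem_support_iff.1 hc)
  rw [← hcd, Finsupp.degree_eq_sum, ← Finset.prod_pow_eq_pow_sum]
  simp only [Pi.smul_apply, smul_eq_mul, mul_pow, Finset.prod_mul_distrib]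
  ring

lemma dehomogenize_ne_zero [Infinite L] (l : Fin n → L) {F : MvPolynomial (Fin (n + 1)) L} {d : ℕ}
    (hF : F.IsHomogeneous d) (hF0 : F ≠ 0) : dehomogenize l F ≠ 0 := by
  intro h
  refine hF0 (eq_of_eval_eq_of_chartForm_ne_zero l fun x hx => ?_)
  calc
    eval x F = eval (eval x (chartForm l) •
        chartPoint l fun i => x i.succ / eval x (chartForm l)) F :=
      congrArg (fun y => eval y F) (eq_smul_chartPoint l hx)
    _ = eval x 0 := by
      rw [hF.eval_smul_eq, ← eval_dehomogenize, h, map_zero, mul_zero, map_zero]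

lemma translate_dehomogenize_mem (l w : Fin n → L) {F : MvPolynomial (Fin (n + 1)) L} {m : ℕ}
    (hF : translate (chartPoint l w) F ∈ idealOfVars _ L ^ m) :
    translate w (dehomogenize l F) ∈ idealOfVars (Fin n) L ^ m := by
  have h : translate w (dehomogenize l F) =
      aeval (Fin.cons (-∑ i, C (l i) * X i) X) (translate (chartPoint l w) F) := by
    clear hF
    induction F using MvPolynomial.induction_on with
    | C a => simp [dehomogenize]
    | add P Q hP hQ => rw [map_add, map_add, map_add, map_add, hP, hQ]
    | mul_X P i hP =>
      rw [map_mul, map_mul, map_mul, map_mul, hP]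
      congr 1
      refine Fin.cases ?_ (fun i => ?_) i
      · simp only [dehomogenize, chartPoint, translate_X, aeval_X, Fin.cons_zero, map_sub, map_one,
          map_sum, map_mul, map_add, translate_C, aeval_C, algebraMap_eq, mul_add,
          Finset.sum_add_distrib]
        ring
      · simp [dehomogenize, chartPoint, translate_X]
  rw [h]
  refine aeval_mem_pow_idealOfVars (fun i => ?_) hF
  refine Fin.cases ?_ (fun i => ?_) i
  · rw [Fin.cons_zero, neg_mem_iff]
    exact sum_mem fun i _ => Ideal.mul_mem_left _ _ (X_mem_idealOfVars _)
  · exact X_mem_idealOfVars _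

/-- Homogenization in degree `t`, through the Taylor expansion at `w`. -/
noncomputable def homogenizeAt (l : Fin n → L) (t : ℕ) (w : Fin n → L)
    (g : MvPolynomial (Fin n) L) : MvPolynomial (Fin (n + 1)) L :=
  ∑ c ∈ (translate w g).support, C (coeff c (translate w g)) *
    ((∏ i, (X i.succ - C (w i) * chartForm l) ^ c i) * chartForm l ^ (t - c.degree))

lemma eval_homogenizeAt (l : Fin n → L) {t : ℕ} (w : Fin n → L) {g : MvPolynomial (Fin n) L}
    (hg : g.totalDegree ≤ t) {x : Fin (n + 1) → L} (hx : eval x (chartForm l) ≠ 0) :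
    eval x (homogenizeAt l t w g) =
      eval x (chartForm l) ^ t * eval (fun i => x i.succ / eval x (chartForm l)) g := by
  have h1 : eval (fun i => x i.succ / eval x (chartForm l)) g =
      eval (fun i => x i.succ / eval x (chartForm l) - w i) (translate w g) := by
    rw [eval_translate]
    congr 2
    funext i
    simp
  rw [h1, eval_eq' _ (translate w g), homogenizeAt, map_sum, Finset.mul_sum]
  refine Finset.sum_congr rfl fun c hc => ?_
  have hct : c.degree ≤ t := (le_totalDegree hc).trans ((totalDegree_translate_le w g).trans hg)
  rw [← Nat.sub_add_cancel hct, pow_add, Finsupp.degree_eq_sum, ← Finset.prod_pow_eq_pow_sum]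
  simp only [map_mul, map_prod, map_pow, map_sub, eval_X, eval_C, Nat.add_sub_cancel]
  have h2 : ∏ i, (x i.succ - w i * eval x (chartForm l)) ^ c i =
      (∏ i, eval x (chartForm l) ^ c i) *
        ∏ i, (x i.succ / eval x (chartForm l) - w i) ^ c i := by
    rw [← Finset.prod_mul_distrib]
    refine Finset.prod_congr rfl fun i _ => ?_
    rw [← mul_pow]
    congr 1
    field_simp
  rw [h2]
  ring

lemma homogenizeAt_eq [Infinite L] (l : Fin n → L) {t : ℕ} (w w' : Fin n → L)
    {g : MvPolynomial (Fin n) L} (hg : g.totalDegree ≤ t) :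
    homogenizeAt l t w g = homogenizeAt l t w' g :=
  eq_of_eval_eq_of_chartForm_ne_zero l fun x hx => by
    rw [eval_homogenizeAt l w hg hx, eval_homogenizeAt l w' hg hx]

lemma homogenizeAt_ne_zero [Infinite L] (l : Fin n → L) {t : ℕ} (w : Fin n → L)
    {g : MvPolynomial (Fin n) L} (hg : g.totalDegree ≤ t) (hg0 : g ≠ 0) :
    homogenizeAt l t w g ≠ 0 := by
  intro h
  refine hg0 (MvPolynomial.funext fun y => ?_)
  have := eval_homogenizeAt l w hg (x := chartPoint l y) (by simp [eval_chartPoint_chartForm])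
  rw [h, eval_chartPoint_chartForm] at this
  simpa [chartPoint] using this.symm

lemma isHomogeneous_homogenizeAt (l : Fin n → L) {t : ℕ} (w : Fin n → L)
    {g : MvPolynomial (Fin n) L} (hg : g.totalDegree ≤ t) :
    (homogenizeAt l t w g).IsHomogeneous t := by
  refine IsHomogeneous.sum _ _ _ fun c hc => ?_
  have hct : c.degree ≤ t := (le_totalDegree hc).trans ((totalDegree_translate_le w g).trans hg)
  have hlin (i : Fin n) :
      (X i.succ - C (w i) * chartForm l : MvPolynomial (Fin (n + 1)) L).IsHomogeneous 1 :=
    (isHomogeneous_X _ _).sub ((isHomogeneous_chartForm l).C_mul (w i))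
  have hprod : (∏ i, (X i.succ - C (w i) * chartForm l : MvPolynomial (Fin (n + 1)) L) ^
      c i).IsHomogeneous c.degree := by
    rw [Finsupp.degree_eq_sum]
    refine IsHomogeneous.prod _ _ _ fun i _ => ?_
    have := (hlin i).pow (c i)
    rwa [one_mul] at this
  have hpow := (isHomogeneous_chartForm l).pow (t - c.degree)
  rw [one_mul] at hpow
  have := (hprod.mul hpow).C_mul (coeff c (translate w g))
  rwa [Nat.add_sub_cancel' hct] at this

lemma translate_homogenizeAt_mem (l : Fin n → L) {t k : ℕ} (w : Fin n → L)
    {g : MvPolynomial (Fin n) L} (hg : translate w g ∈ idealOfVars (Fin n) L ^ k)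
    {v : Fin (n + 1) → L} (hv : ∀ i, v i.succ = w i * eval v (chartForm l)) :
    translate v (homogenizeAt l t w g) ∈ idealOfVars (Fin (n + 1)) L ^ k := by
  rw [homogenizeAt, map_sum]
  refine sum_mem fun c hc => ?_
  rw [map_mul, map_mul]
  refine Ideal.mul_mem_left _ _ (Ideal.mul_mem_right _ _ ?_)
  refine Ideal.pow_le_pow_right ((mem_pow_idealOfVars_iff k _).1 hg c hc) ?_
  rw [Finsupp.degree_eq_sum, ← Finset.prod_pow_eq_pow_sum, map_prod]
  refine Ideal.prod_mem_prod fun i _ => ?_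
  rw [map_pow]
  refine Ideal.pow_mem_pow ?_ _
  have : translate v (X i.succ - C (w i) * chartForm l) = X i.succ - C (w i) * chartForm l := by
    rw [map_sub, map_mul, translate_X, translate_C, translate_chartForm, hv, map_mul]
    ring
  rw [this]
  exact sub_mem (X_mem_idealOfVars _) (Ideal.mul_mem_left _ _ (chartForm_mem_idealOfVars l))

lemma exists_chartForm_ne_zero [Infinite L] {ι : Type*} [Fintype ι] (v : ι → Fin (n + 1) → L)
    (hv : ∀ j, v j ≠ 0) : ∃ l : Fin n → L, ∀ j, eval (v j) (chartForm l) ≠ 0 := by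
  set Q : ι → MvPolynomial (Fin n) L := fun j => C (v j 0) + ∑ i, C (v j i.succ) * X i with hQ
  have hev (j : ι) (l : Fin n → L) : eval l (Q j) = eval (v j) (chartForm l) := by
    simp [hQ, eval_chartForm, mul_comm]
  have hQ0 (j : ι) : Q j ≠ 0 := by
    intro h
    have h0 : v j 0 = 0 := by simpa [h, eval_chartForm] using (hev j 0).symm
    refine hv j (_root_.funext fun i => Fin.cases h0 (fun i => ?_) i)
    simpa [h, eval_chartForm, h0, Pi.single_apply] using (hev j (Pi.single i 1)).symm
  have hprod : ∏ j, Q j ≠ 0 := Finset.prod_ne_zero_iff.2 fun j _ => hQ0 j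
  by_contra! hcon
  refine hprod (MvPolynomial.funext fun l => ?_)
  obtain ⟨j, hj⟩ := hcon l
  rw [map_prod, map_zero]
  exact Finset.prod_eq_zero (Finset.mem_univ j) ((hev j l).trans hj)

end Chart

end MvPolynomial

open MvPolynomial in
lemma vanishesToOrder_iff {n m : ℕ} {F : MvPolynomial (Fin (n + 1)) ℂ} {v : Fin (n + 1) → ℂ} :
    VanishesToOrder n m F v ↔ translate v F ∈ idealOfVars (Fin (n + 1)) ℂ ^ m := by
  have key (l : List (Fin (n + 1))) (G : MvPolynomial (Fin (n + 1)) ℂ) :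
      eval 0 (l.foldl (fun Q i => pderiv i Q) (translate v G)) =
        eval v (l.foldl (fun Q i => pderiv i Q) G) := by
    induction l generalizing G with
    | nil => rw [List.foldl_nil, List.foldl_nil, eval_translate, zero_add]
    | cons i l ih => rw [List.foldl_cons, List.foldl_cons, pderiv_translate, ih]
  rw [← mem_pow_idealOfVars_iff_foldl_pderiv]
  simp only [key]
  constructor
  · intro h l hl
    simpa using h l.length hl l.get
  · intro h k hk d
    exact h _ (by simpa using hk)

open MvPolynomial in
/-- A finite set of points of projective space lies in the affine chart `chartForm l ≠ 0` for some
`l`; the points have affine coordinates `w`. -/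
lemma exists_affineCoordinates {n : ℕ} {Z : Set (ℙ ℂ (Fin (n + 1) → ℂ))} [Fintype Z] :
    ∃ (l : Fin n → ℂ) (w : Z → Fin n → ℂ), ∀ P : Z,
      (∃ h, Projectivization.mk ℂ (chartPoint l (w P)) h = P) ∧
      ∀ v hv, Projectivization.mk ℂ v hv = (P : ℙ ℂ (Fin (n + 1) → ℂ)) →
        ∀ i, v i.succ = w P i * eval v (chartForm l) := by
  obtain ⟨l, hl⟩ := exists_chartForm_ne_zero (fun P : Z => P.1.rep) fun P => P.1.rep_nonzero
  refine ⟨l, fun P i => P.1.rep i.succ / eval P.1.rep (chartForm l), fun P => ⟨?_, ?_⟩⟩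
  · have hP := eq_smul_chartPoint l (hl P)
    have h0 : chartPoint l (fun i => P.1.rep i.succ / eval P.1.rep (chartForm l)) ≠ 0 := by
      intro h
      rw [h, smul_zero] at hP
      exact P.1.rep_nonzero hP
    refine ⟨h0, ?_⟩
    conv_rhs => rw [← P.1.mk_rep]
    exact ((Projectivization.mk_eq_mk_iff' ℂ _ _ P.1.rep_nonzero h0).2 ⟨_, hP.symm⟩).symm
  · intro v hv hvP i
    rw [← P.1.mk_rep, Projectivization.mk_eq_mk_iff'] at hvP
    obtain ⟨a, rfl⟩ := hvP
    rw [(isHomogeneous_chartForm l).eval_smul_eq, pow_one, Pi.smul_apply, smul_eq_mul]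
    field_simp [hl P]

open MvPolynomial in
lemma add_one_mul_initialDegree_le {n : ℕ} (hn : 2 ≤ n) {Z : Set (ℙ ℂ (Fin (n + 1) → ℂ))}
    (hfin : Z.Finite) (hne : Z.Nonempty) {k m : ℕ} (hk : 1 ≤ k) (hm : 1 ≤ m) :
    (initialDegree n (symbolicPower n Z k) + 1) * m ≤
      (k + n - 1) * initialDegree n (symbolicPower n Z m) := by
  classical
  have := hfin.fintype
  have := hne.to_subtype
  obtain ⟨l, w, hw⟩ := exists_affineCoordinates (Z := Z)
  have hhom {s : ℕ} {g : MvPolynomial (Fin n) ℂ} (hg0 : g ≠ 0)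
      (hg : ∀ P, translate (w P) g ∈ idealOfVars (Fin n) ℂ ^ s) :
      g.totalDegree ∈ {t | ∃ F ∈ symbolicPower n Z s, F ≠ 0 ∧ F.IsHomogeneous t} := by
    refine ⟨homogenizeAt l g.totalDegree 0 g, ?_, homogenizeAt_ne_zero l 0 le_rfl hg0,
      isHomogeneous_homogenizeAt l 0 le_rfl⟩
    intro P hP v hv hvP
    rw [vanishesToOrder_iff, homogenizeAt_eq l 0 (w ⟨P, hP⟩) le_rfl]
    exact translate_homogenizeAt_mem l _ (hg ⟨P, hP⟩) ((hw ⟨P, hP⟩).2 v hv hvP)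
  have hα (g : MvPolynomial (Fin n) ℂ)
      (hg : ∀ c, initialDegree n (symbolicPower n Z k) ≤ c.degree → coeff c g = 0)
      (hgk : ∀ P, translate (w P) g ∈ idealOfVars (Fin n) ℂ ^ k) : g = 0 := by
    by_contra hg0
    obtain ⟨c, hc, hcg⟩ := Finset.exists_mem_eq_sup g.support (support_nonempty.2 hg0)
      fun c => c.degree
    refine mem_support_iff.1 hc (hg c ?_)
    rw [← hcg]
    exact Nat.sInf_le (hhom hg0 hgk)
  have hnonempty : {t | ∃ F ∈ symbolicPower n Z m, F ≠ 0 ∧ F.IsHomogeneous t}.Nonempty := by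
    let i : Fin n := ⟨0, by omega⟩
    refine ⟨_, hhom (g := ∏ P, (X i - C (w P i)) ^ m) ?_ fun P => ?_⟩
    · refine Finset.prod_ne_zero_iff.2 fun P _ => pow_ne_zero _ fun h => ?_
      simpa using congrArg (eval fun _ => w P i + 1) h
    · rw [map_prod, ← Finset.mul_prod_erase _ _ (Finset.mem_univ P)]
      refine Ideal.mul_mem_right _ _ ?_
      rw [map_pow, map_sub, translate_X, translate_C, add_sub_cancel_right]
      exact Ideal.pow_mem_pow (X_mem_idealOfVars i) m
  obtain ⟨F, hFm, hF0, hF⟩ := Nat.sInf_mem hnonempty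
  have := degree_bound (by simpa using hn) w hk hm (dehomogenize_ne_zero l hF hF0)
    ((totalDegree_dehomogenize_le l F).trans hF.totalDegree_le)
    (fun P => translate_dehomogenize_mem l (w P) ?_) hα (eq_zero_of_succ_order hα)
  · rwa [Fintype.card_fin] at this
  · obtain ⟨h, hP⟩ := (hw P).1
    exact vanishesToOrder_iff.1 (hFm P P.2 _ h hP)

/-- The Esnault–Viehweg inequality: for the radical ideal `I` of a finite nonempty set of points
in `ℙⁿ`, `n ≥ 2`, and integers `1 ≤ k ≤ m`, one has
`(α(I^(k)) + 1)/(k + n - 1) ≤ α(I^(m))/m`, and in particular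
`(α(I^(k)) + 1)/(k + n - 1) ≤ α̂(I)`. -/
theorem esnault_viehweg (n : ℕ) (hn : 2 ≤ n) (Z : Set (ℙ ℂ (Fin (n + 1) → ℂ)))
    (hfin : Z.Finite) (hne : Z.Nonempty) (k m : ℕ) (hk : 1 ≤ k) (hkm : k ≤ m) :
    ((initialDegree n (symbolicPower n Z k) : ℝ) + 1) / ((k : ℝ) + (n : ℝ) - 1) ≤
        (initialDegree n (symbolicPower n Z m) : ℝ) / (m : ℝ) ∧
      ((initialDegree n (symbolicPower n Z k) : ℝ) + 1) / ((k : ℝ) + (n : ℝ) - 1) ≤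
        waldschmidt n Z := by
  have key (s : ℕ) (hs : 1 ≤ s) :
      ((initialDegree n (symbolicPower n Z k) : ℝ) + 1) / ((k : ℝ) + (n : ℝ) - 1) ≤
        (initialDegree n (symbolicPower n Z s) : ℝ) / (s : ℝ) := by
    have hcast : ((k + n - 1 : ℕ) : ℝ) = (k : ℝ) + (n : ℝ) - 1 := by
      rw [Nat.cast_sub (by omega)]
      push_cast
      ring
    have hpos : 0 < k + n - 1 := by omega
    rw [← hcast, div_le_div_iff₀ (by exact_mod_cast hpos) (by exact_mod_cast hs),
      mul_comm (initialDegree n (symbolicPower n Z s) : ℝ)]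
    exact_mod_cast add_one_mul_initialDegree_le hn hfin hne hk hs
  exact ⟨key m (hk.trans hkm), le_ciInf fun s => key s s.pos⟩
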